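/- Let ℓ : ℝ → ℝ be smooth, let h : ℝ² → ℝ be a smooth nowhere-vanishing function of (v,w), and set g(v,w) = ℓ(v) h(v,w). Then a smooth function F : ℝ³ → ℝ of (u,v,w) satisfies the full hydrodynamic Casimir system for the operator C_{3,2} with f = 0 — namely ∂²F/∂u² = ∂²F/∂u∂v = ∂²F/∂u∂w = 0 together with g(v,w) ∂F/∂w = 0, h(v,w) ∂F/∂w = 0 and g(v,w) ∂F/∂u + h(v,w) ∂F/∂v = 0 at every point of ℝ³ — if and only if there exist constants α, β ∈ ℝ such that F(u,v,w) = α ( u − ∫₀^v ℓ(s) ds ) + β for all (u,v,w) ∈ ℝ³. -/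

import Mathlib

open scoped BigOperators

/-- Partial derivative in the `i`-th coordinate direction on `ℝⁿ`. -/
noncomputable def pd {n : ℕ} (i : Fin n) (f : (Fin n → ℝ) → ℝ) : (Fin n → ℝ) → ℝ :=
  fun u => fderiv ℝ f u (Pi.single i 1)

theorem pd_comm {n : ℕ} {f : (Fin n → ℝ) → ℝ} (hf : ContDiff ℝ (⊤ : ℕ∞) f) (i j : Fin n)
    (x : Fin n → ℝ) : pd i (pd j f) x = pd j (pd i f) x := by
  have hd : DifferentiableAt ℝ (fderiv ℝ f) x :=
    (hf.fderiv_right (m := 1) (by norm_cast)).differentiable one_ne_zero x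
  have key (k l : Fin n) : pd k (pd l f) x
      = fderiv ℝ (fderiv ℝ f) x (Pi.single k 1) (Pi.single l 1) := by
    have hD := (hd.hasFDerivAt.clm_apply
      (hasFDerivAt_const (Pi.single l 1 : Fin n → ℝ) x)).fderiv
    refine (congrArg (fun L => L (Pi.single k 1)) hD).trans ?_
    simp
  rw [key, key]
  have hmin : minSmoothness ℝ 2 ≤ ((⊤ : ℕ∞) : WithTop ℕ∞) := by
    rw [minSmoothness_of_isRCLikeNormedField]
    norm_cast
  exact (hf.contDiffAt.isSymmSndFDerivAt hmin).eq _ _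

theorem differentiable_pd {n : ℕ} {f : (Fin n → ℝ) → ℝ} (hf : ContDiff ℝ (⊤ : ℕ∞) f) (i : Fin n) :
    Differentiable ℝ (pd i f) :=
  ((hf.fderiv_right (m := 1) (by norm_cast)).differentiable one_ne_zero).clm_apply
    (differentiable_const _)

theorem eq_of_pd_eq_zero {n : ℕ} {f : (Fin n → ℝ) → ℝ} (hf : Differentiable ℝ f)
    (h : ∀ i x, pd i f x = 0) (x y : Fin n → ℝ) : f x = f y := by
  refine is_const_of_fderiv_eq_zero hf (fun z => ?_) x y
  apply ContinuousLinearMap.coe_injective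
  refine LinearMap.pi_ext' fun i => LinearMap.ext_ring ?_
  simpa [pd] using h i z

theorem hasFDerivAt_sub_integral {ℓ : ℝ → ℝ} (hℓ : Continuous ℓ) (α : ℝ) (x : Fin 3 → ℝ) :
    HasFDerivAt (fun x : Fin 3 → ℝ => α * (x 0 - ∫ s in (0:ℝ)..(x 1), ℓ s))
      (α • (ContinuousLinearMap.proj (R := ℝ) (φ := fun _ : Fin 3 => ℝ) 0
        - ℓ (x 1) • ContinuousLinearMap.proj (R := ℝ) (φ := fun _ : Fin 3 => ℝ) 1)) x :=
  ((hasFDerivAt_apply (𝕜 := ℝ) (0 : Fin 3) x).fun_sub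
    (HasDerivAt.comp_hasFDerivAt (h₂ := fun v => ∫ s in (0:ℝ)..v, ℓ s) x
      (hℓ.integral_hasStrictDerivAt 0 (x 1)).hasDerivAt
      (hasFDerivAt_apply (𝕜 := ℝ) (1 : Fin 3) x))).const_mul α

/-- Full hydrodynamic Casimirs of the operator `C_{3,2}` in the case `f = 0`,
`g = ℓ(v) h(v,w)`, `h` nowhere vanishing.  Coordinates: index `0` is `u`,
index `1` is `v`, index `2` is `w`. -/
theorem full_casimir_C32_f_eq_zero
    (ℓ : ℝ → ℝ) (hℓ : ContDiff ℝ (⊤ : ℕ∞) ℓ)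
    (h : ℝ → ℝ → ℝ) (hh : ContDiff ℝ (⊤ : ℕ∞) (Function.uncurry h))
    (hh_ne : ∀ v w, h v w ≠ 0)
    (g : ℝ → ℝ → ℝ) (hg : ∀ v w, g v w = ℓ v * h v w)
    (F : (Fin 3 → ℝ) → ℝ) (hF : ContDiff ℝ (⊤ : ℕ∞) F) :
    ((∀ x : Fin 3 → ℝ, pd 0 (pd 0 F) x = 0)
      ∧ (∀ x : Fin 3 → ℝ, pd 0 (pd 1 F) x = 0)
      ∧ (∀ x : Fin 3 → ℝ, pd 0 (pd 2 F) x = 0)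
      ∧ (∀ x : Fin 3 → ℝ, g (x 1) (x 2) * pd 2 F x = 0)
      ∧ (∀ x : Fin 3 → ℝ, h (x 1) (x 2) * pd 2 F x = 0)
      ∧ (∀ x : Fin 3 → ℝ, g (x 1) (x 2) * pd 0 F x + h (x 1) (x 2) * pd 1 F x = 0))
      ↔ ∃ α β : ℝ,
          ∀ x : Fin 3 → ℝ, F x = α * (x 0 - ∫ s in (0:ℝ)..(x 1), ℓ s) + β := by
  constructor
  · rintro ⟨h00, h01, h02, -, hw, huv⟩
    have hG (x) : pd 0 F x = pd 0 F 0 := by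
      refine eq_of_pd_eq_zero (differentiable_pd hF 0) (fun i y => ?_) x 0
      fin_cases i
      · exact h00 y
      · exact (pd_comm hF 1 0 y).trans (h01 y)
      · exact (pd_comm hF 2 0 y).trans (h02 y)
    have hw' (x) : pd 2 F x = 0 := (mul_eq_zero.mp (hw x)).resolve_left (hh_ne _ _)
    have hv (x : Fin 3 → ℝ) : pd 1 F x = -(pd 0 F 0 * ℓ (x 1)) := by
      have := huv x
      rw [hg, hG] at this
      apply mul_left_cancel₀ (hh_ne (x 1) (x 2))
      linear_combination this
    have hFd : Differentiable ℝ F := hF.differentiable (by simp)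
    have hΨ := hasFDerivAt_sub_integral hℓ.continuous (pd 0 F 0)
    refine ⟨pd 0 F 0, F 0, fun x => ?_⟩
    have hconst := eq_of_pd_eq_zero
      (f := fun x => F x - pd 0 F 0 * (x 0 - ∫ s in (0:ℝ)..(x 1), ℓ s))
      (fun y => (hFd y).sub (hΨ y).differentiableAt) (fun i y => ?_) x 0
    · simp only [Pi.zero_apply, intervalIntegral.integral_same, sub_zero, mul_zero] at hconst
      linear_combination hconst
    · have hD := ((hFd y).hasFDerivAt.sub (hΨ y)).fderiv
      have hsplit : pd i (fun x => F x - pd 0 F 0 * (x 0 - ∫ s in (0:ℝ)..(x 1), ℓ s)) y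
          = pd i F y - pd 0 F 0 * ((Pi.single i 1 : Fin 3 → ℝ) 0
            - ℓ (y 1) * (Pi.single i 1 : Fin 3 → ℝ) 1) :=
        congrArg (fun L => L (Pi.single i 1)) hD
      rw [hsplit]
      fin_cases i
      · simp [hG y]
      · simp [hv y]
      · simp [hw' y]
  · rintro ⟨α, β, hFx⟩
    have hp (i : Fin 3) : pd i F = fun x => α * ((Pi.single i 1 : Fin 3 → ℝ) 0
        - ℓ (x 1) * (Pi.single i 1 : Fin 3 → ℝ) 1) := by
      funext x
      have hD := ((hasFDerivAt_sub_integral hℓ.continuous α x).add_const β).fderiv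
      rw [← funext hFx] at hD
      exact congrArg (fun L => L (Pi.single i 1)) hD
    have h0 : pd 0 F = fun _ => α := by simp [hp]
    have h1 (x : Fin 3 → ℝ) : pd 1 F x = -(α * ℓ (x 1)) := by simp [hp]
    have h2 : pd 2 F = fun _ => 0 := by simp [hp]
    have hc (i) (x) : pd i (pd 0 F) x = 0 := by simp [h0, pd]
    refine ⟨hc 0, fun x => (pd_comm hF 0 1 x).trans (hc 1 x),
      fun x => (pd_comm hF 0 2 x).trans (hc 2 x), by simp [h2], by simp [h2], fun x => ?_⟩
    rw [h0, h1, hg]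
    ring
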